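/- arXiv:1510.05260 — 2 statements merged into one kernel-verified Lean document; each statement's English description precedes it below -/
import Mathlib

section
/- There exists N₀ such that for every integer N ≥ N₀ the following holds: if a₀ is a non-negative integer, d ≥ 1, and a₁, …, a_d are positive integers (not necessarily distinct) such that every element of the Hilbert cube H(a₀; a₁, …, a_d) is a positive perfect square and is at most N, then d ≤ 7 · log log N (natural logarithms). -/
/-- There are no nonzero integers `p`, `s` such that `p² + s²` and `p² + 4s²` are both squares. -/
theorem not_sq_add_sq_and_sq_add_four_mul_sq {p s r q : ℤ} (hp : p ≠ 0) (hs : s ≠ 0)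
    (h₁ : p ^ 2 + s ^ 2 = r ^ 2) (h₂ : p ^ 2 + 4 * s ^ 2 = q ^ 2) : False := by
  induction hn : (p * s).natAbs using Nat.strong_induction_on generalizing p s r q with
  | _ n ih =>
  subst hn
  have hr : r ≠ 0 := by
    rintro rfl
    have := pow_pos (abs_pos.mpr hp) 2
    rw [sq_abs] at this
    nlinarith [sq_nonneg s]
  have hq : q ≠ 0 := by
    rintro rfl
    have := pow_pos (abs_pos.mpr hp) 2
    rw [sq_abs] at this
    nlinarith [sq_nonneg s]
  by_cases hg : Int.gcd p s = 1
  swap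
  · obtain ⟨p', hp'⟩ := Int.gcd_dvd_left p s
    obtain ⟨s', hs'⟩ := Int.gcd_dvd_right p s
    have hg0 : Int.gcd p s ≠ 0 := by simp [Int.gcd_eq_zero_iff, hp]
    generalize Int.gcd p s = g at *
    have hgz : (g : ℤ) ≠ 0 := by exact_mod_cast hg0
    subst hp' hs'
    have hr' : (g : ℤ) ∣ r := by
      rw [← Int.pow_dvd_pow_iff (two_ne_zero), ← h₁]
      exact ⟨p' ^ 2 + s' ^ 2, by ring⟩
    have hq' : (g : ℤ) ∣ q := by
      rw [← Int.pow_dvd_pow_iff (two_ne_zero), ← h₂]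
      exact ⟨p' ^ 2 + 4 * s' ^ 2, by ring⟩
    obtain ⟨r', rfl⟩ := hr'
    obtain ⟨q', rfl⟩ := hq'
    have hp0 : p' ≠ 0 := right_ne_zero_of_mul hp
    have hs0 : s' ≠ 0 := right_ne_zero_of_mul hs
    refine ih (p' * s').natAbs ?_ hp0 hs0 (r := r') (q := q') ?_ ?_ rfl
    · have : 0 < (p' * s').natAbs := Int.natAbs_pos.mpr (mul_ne_zero hp0 hs0)
      have hlt : 2 ≤ g := by omega
      have : (g * p' * (g * s')).natAbs = g * g * (p' * s').natAbs := by
        rw [show (g : ℤ) * p' * (g * s') = (g * g : ℕ) * (p' * s') by push_cast; ring,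
          Int.natAbs_mul, Int.natAbs_natCast]
      rw [this]
      have : 2 * 1 ≤ g * g := Nat.mul_le_mul hlt (by omega)
      nlinarith
    · exact mul_left_cancel₀ (pow_ne_zero 2 hgz) (by linear_combination h₁)
    · exact mul_left_cancel₀ (pow_ne_zero 2 hgz) (by linear_combination h₂)
  rcases Int.even_or_odd' p with ⟨p', hp' | hp'⟩
  · subst hp'
    have hq' : (2 : ℤ) ∣ q := by
      rw [← Int.pow_dvd_pow_iff (two_ne_zero), ← h₂]
      exact ⟨p' ^ 2 + s ^ 2, by ring⟩
    obtain ⟨q', rfl⟩ := hq'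
    have hp0 : p' ≠ 0 := right_ne_zero_of_mul hp
    refine ih (s * p').natAbs ?_ hs hp0 (r := q') (q := r) ?_ ?_ rfl
    · have : 0 < (s * p').natAbs := Int.natAbs_pos.mpr (mul_ne_zero hs hp0)
      rw [show 2 * p' * s = 2 * (s * p') by ring, Int.natAbs_mul 2]
      rw [show (2 : ℤ).natAbs = 2 from rfl]
      omega
    · linarith
    · linarith
  have hpodd : p % 2 = 1 := by omega
  obtain ⟨X, Y, hX, hY, -, hXY, -, -⟩ :=
    PythagoreanTriple.coprime_classification' (x := p) (y := s) (z := |r|)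
      (by unfold PythagoreanTriple; rw [abs_mul_abs_self]; linarith) hg hpodd (abs_pos.mpr hr)
  obtain ⟨A, B, hA, hB, -, hAB, -, -⟩ :=
    PythagoreanTriple.coprime_classification' (x := p) (y := 2 * s) (z := |q|)
      (by unfold PythagoreanTriple; rw [abs_mul_abs_self]; linarith)
      (by
        rw [← Int.isCoprime_iff_gcd_eq_one] at hg ⊢
        exact IsCoprime.mul_right ⟨1, -p', by rw [hp']; ring⟩ hg) hpodd (abs_pos.mpr hq)
  have key : ∀ A B X Y : ℤ, IsCoprime A B → IsCoprime X Y → Even B → A * B = s →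
      2 * X * Y = s → A ^ 2 - B ^ 2 = X ^ 2 - Y ^ 2 → False := by
    intro A B X Y hAB hXY hB hAs hXs hsq
    obtain ⟨y, rfl⟩ := hB
    have hA0 : A ≠ 0 := by rintro rfl; simp at hAs; exact hs hAs.symm
    have hmul : A * y = X * Y := by linarith
    obtain ⟨u, v, ⟨w, rfl⟩, ⟨z, rfl⟩, rfl⟩ := exists_dvd_and_dvd_of_dvd_mul (Dvd.intro y hmul)
    have hy : y = w * z := mul_left_cancel₀ hA0 (by linarith)
    subst hy
    have hne : u * v * (w * z) ≠ 0 := by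
      intro h; apply hs; rw [← hAs]; linear_combination 2 * h
    have hu : u ≠ 0 := by rintro rfl; simp at hne
    have hv : v ≠ 0 := by rintro rfl; simp at hne
    have hw : w ≠ 0 := by rintro rfl; simp at hne
    have hz : z ≠ 0 := by rintro rfl; simp at hne
    have heq : v ^ 2 * (u ^ 2 + z ^ 2) = w ^ 2 * (u ^ 2 + 4 * z ^ 2) := by
      linear_combination hsq
    have hvw : IsCoprime v w :=
      (hAB.of_isCoprime_of_dvd_left (dvd_mul_left v u)).of_isCoprime_of_dvd_right
        ⟨2 * z, by ring⟩
    have huz : IsCoprime u z :=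
      (hAB.of_isCoprime_of_dvd_left (dvd_mul_right u v)).of_isCoprime_of_dvd_right
        ⟨2 * w, by ring⟩
    obtain ⟨l, hl⟩ : w ^ 2 ∣ u ^ 2 + z ^ 2 :=
      (hvw.symm.pow (m := 2) (n := 2)).dvd_of_dvd_mul_left ⟨_, heq⟩
    have hl' : u ^ 2 + 4 * z ^ 2 = v ^ 2 * l :=
      mul_left_cancel₀ (pow_ne_zero 2 hw) (by rw [← heq, hl]; ring)
    have hl3 : l ∣ 3 := by
      have hlu : l ∣ 3 * u ^ 2 := ⟨4 * w ^ 2 - v ^ 2, by linear_combination 4 * hl - hl'⟩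
      have hlz : l ∣ 3 * z ^ 2 := ⟨v ^ 2 - w ^ 2, by linear_combination hl' - hl⟩
      obtain ⟨e, f, hef⟩ := huz.pow (m := 2) (n := 2)
      have : (3 : ℤ) = e * (3 * u ^ 2) + f * (3 * z ^ 2) := by linear_combination -3 * hef
      rw [this]
      exact dvd_add (hlu.mul_left e) (hlz.mul_left f)
    have hlpos : 0 < l := by
      have h1 : 0 < u ^ 2 + z ^ 2 := by positivity
      rw [hl] at h1
      exact pos_of_mul_pos_right h1 (by positivity)
    have hl13 : l = 1 ∨ l = 3 := by
      have := Int.le_of_dvd (by norm_num) hl3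
      interval_cases l <;> omega
    rcases hl13 with rfl | rfl
    · refine ih (u * z).natAbs ?_ hu hz (by simpa using hl) (by simpa using hl') rfl
      have h1 : 0 < (u * z).natAbs := Int.natAbs_pos.mpr (mul_ne_zero hu hz)
      have h2 : 0 < (v * w).natAbs := Int.natAbs_pos.mpr (mul_ne_zero hv hw)
      have h3 : 0 < p.natAbs := Int.natAbs_pos.mpr hp
      rw [← hAs, show p * (u * v * (w * z + w * z)) = 2 * (p * ((v * w) * (u * z))) by ring,
        Int.natAbs_mul 2, Int.natAbs_mul p, Int.natAbs_mul (v * w)]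
      have h4 : 1 ≤ p.natAbs * (v * w).natAbs := Nat.mul_pos h3 h2
      rw [show (2 : ℤ).natAbs = 2 from rfl]
      nlinarith
    · have h3 : (u ^ 2 + z ^ 2) % 3 = 0 := by omega
      have hu3 : u % 3 = 0 ∨ u % 3 = 1 ∨ u % 3 = 2 := by omega
      have hz3 : z % 3 = 0 ∨ z % 3 = 1 ∨ z % 3 = 2 := by omega
      have h33 : u % 3 = 0 ∧ z % 3 = 0 := by
        rcases hu3 with h | h | h <;> rcases hz3 with h' | h' | h' <;>
          simp [pow_two, Int.add_emod, Int.mul_emod, h, h'] at h3 ⊢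
      have := huz.isUnit_of_dvd' (Int.dvd_of_emod_eq_zero h33.1) (Int.dvd_of_emod_eq_zero h33.2)
      exact absurd (Int.isUnit_iff.mp this) (by norm_num)
  rw [← Int.isCoprime_iff_gcd_eq_one] at hXY hAB
  rcases Int.even_or_odd B with hBe | hBo
  · exact key A B X Y hAB hXY hBe (by linarith) hY.symm (by rw [← hA, ← hX])
  · refine key B A Y X hAB.symm hXY.symm ?_ (by linarith) (by linarith) (by linarith)
    by_contra hAe
    rw [Int.not_even_iff_odd] at hAe
    have : Even p := by rw [hA]; exact (hAe.pow).sub_odd (hBo.pow)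
    rw [Int.even_iff] at this
    omega

/-- Fermat: there are no four distinct squares in arithmetic progression. -/
theorem not_four_sq_arithmetic_progression {x e a b c d : ℕ} (he : 0 < e) (ha : x = a ^ 2)
    (hb : x + e = b ^ 2) (hc : x + 2 * e = c ^ 2) (hd : x + 3 * e = d ^ 2) : False := by
  have hab : a < b := lt_of_pow_lt_pow_left₀ 2 (Nat.zero_le _) (by omega)
  have hbc : b < c := lt_of_pow_lt_pow_left₀ 2 (Nat.zero_le _) (by omega)
  have hcd : c < d := lt_of_pow_lt_pow_left₀ 2 (Nat.zero_le _) (by omega)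
  zify at *
  obtain ⟨Z, hZ⟩ : ∃ Z : ℤ, Z = b - a := ⟨_, rfl⟩
  obtain ⟨Y, hY⟩ : ∃ Y : ℤ, Y = d - c := ⟨_, rfl⟩
  obtain ⟨W, hW⟩ : ∃ W : ℤ, W = b + a := ⟨_, rfl⟩
  have hZ0 : 0 < Z := by linarith
  have hY0 : 0 < Y := by linarith
  have hW0 : 0 < W := by linarith
  have hYZ : Y < Z := by
    by_contra! h
    have : Z * W = Y * (d + c) := by rw [hZ, hY, hW]; linarith
    nlinarith
  have hrel : (Z ^ 2 - Y ^ 2) * (W ^ 2 - Y ^ 2) = 8 * Y ^ 2 * Z * W := by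
    have h1 : Y * (d + c) = Z * W := by rw [hZ, hY, hW]; linarith
    have h2 : ((d + c : ℤ) - Y) ^ 2 - (W + Z) ^ 2 = 4 * W * Z := by
      rw [hZ, hY, hW]; linarith
    linear_combination Y ^ 2 * h2 - (Y * (d + c) + Z * W - 2 * Y ^ 2) * h1
  have hsq : (2 * Y * W) ^ 2 * (Z ^ 4 + 14 * Y ^ 2 * Z ^ 2 + Y ^ 4) =
      ((Z ^ 2 - Y ^ 2) * (W ^ 2 + Y ^ 2)) ^ 2 := by
    linear_combination (-(Z ^ 2 - Y ^ 2) * (W ^ 2 - Y ^ 2) - 8 * Y ^ 2 * Z * W) * hrel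
  obtain ⟨t₀, ht₀⟩ : 2 * Y * W ∣ (Z ^ 2 - Y ^ 2) * (W ^ 2 + Y ^ 2) := by
    rw [← Int.pow_dvd_pow_iff (two_ne_zero), ← hsq]
    exact dvd_mul_right _ _
  obtain ⟨t, ht, htpos⟩ : ∃ t : ℤ, Z ^ 4 + 14 * Y ^ 2 * Z ^ 2 + Y ^ 4 = t ^ 2 ∧ 0 ≤ t := by
    refine ⟨|t₀|, ?_, abs_nonneg _⟩
    rw [sq_abs]
    refine mul_left_cancel₀ (pow_ne_zero 2 (by positivity : 2 * Y * W ≠ 0)) ?_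
    rw [hsq, ht₀]; ring
  refine not_sq_add_sq_and_sq_add_four_mul_sq
    (p := (t + Y ^ 2 - Z ^ 2) ^ 2 - 16 * Z ^ 4) (s := 4 * (t + Y ^ 2 + 7 * Z ^ 2) * Y * Z)
    (r := (t + Y ^ 2 - Z ^ 2) ^ 2 + 4 * (t + Y ^ 2 - Z ^ 2) * Z ^ 2 + 16 * Z ^ 4)
    (q := (t + Y ^ 2 - Z ^ 2) ^ 2 + 16 * (t + Y ^ 2 - Z ^ 2) * Z ^ 2 + 16 * Z ^ 4)
    ?_ (by positivity) ?_ ?_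
  · intro h
    have h' : (t + Y ^ 2 + 3 * Z ^ 2) * (t + Y ^ 2 - 5 * Z ^ 2) = 0 := by linear_combination h
    rcases mul_eq_zero.mp h' with h' | h'
    · have : 0 < t + Y ^ 2 + 3 * Z ^ 2 := by positivity
      omega
    · have h5 : t = 5 * Z ^ 2 - Y ^ 2 := by linarith
      rw [h5] at ht
      have : 24 * Z ^ 2 * ((Z - Y) * (Z + Y)) = 0 := by linear_combination -ht
      have h6 : 0 < 24 * Z ^ 2 * ((Z - Y) * (Z + Y)) :=
        mul_pos (by positivity) (mul_pos (by linarith) (by linarith))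
      omega
  · linear_combination 8 * Z ^ 2 * (t + Y ^ 2 + 7 * Z ^ 2) * ht
  · linear_combination 32 * Z ^ 2 * (t + Y ^ 2 + 7 * Z ^ 2) * ht

/-- If `X ∪ (X + e)` contains no four-term progression with difference `e`, it has at least
`3/2` as many elements as `X`. -/
theorem three_mul_card_le_two_mul_card_union_image_add {X : Finset ℕ} {e : ℕ}
    (h : ∀ x ∈ X, x + e ∈ X → x + 2 * e ∈ X → False) :
    3 * X.card ≤ 2 * (X ∪ X.image (· + e)).card := by
  have hinj : Function.Injective (· + e : ℕ → ℕ) := add_left_injective e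
  have hunion := Finset.card_union_add_card_inter X (X.image (· + e))
  rw [Finset.card_image_of_injective _ hinj] at hunion
  set Y := X ∩ X.image (· + e) with hY
  have hdisj : Disjoint Y (X.filter (fun x => x + e ∈ X)) := by
    rw [Finset.disjoint_left]
    intro x hx hx'
    simp only [hY, Finset.mem_inter, Finset.mem_image, Finset.mem_filter] at hx hx'
    obtain ⟨-, y, hy, rfl⟩ := hx
    exact h y hy hx'.1 (by have := hx'.2; rwa [add_assoc, ← two_mul] at this)
  have himg : (X.filter (fun x => x + e ∈ X)).image (· + e) = Y := by
    ext y
    simp only [hY, Finset.mem_inter, Finset.mem_image, Finset.mem_filter]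
    constructor
    · rintro ⟨x, ⟨hx, hx'⟩, rfl⟩
      exact ⟨hx', x, hx, rfl⟩
    · rintro ⟨hy, x, hx, rfl⟩
      exact ⟨x, ⟨hx, hy⟩, rfl⟩
  have hcard : Y.card = (X.filter (fun x => x + e ∈ X)).card := by
    rw [← himg, Finset.card_image_of_injective _ hinj]
  have hsub : (Y ∪ X.filter (fun x => x + e ∈ X)).card ≤ X.card :=
    Finset.card_le_card (Finset.union_subset Finset.inter_subset_left (Finset.filter_subset _ _))
  rw [Finset.card_union_of_disjoint hdisj] at hsub
  omega

/-- The set of all subset sums of `a` over subsets of `s`. -/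
def subsetSums {ι : Type*} (a : ι → ℕ) (s : Finset ι) : Finset ℕ :=
  s.powerset.image fun F => ∑ i ∈ F, a i

theorem mem_subsetSums {ι : Type*} {a : ι → ℕ} {s : Finset ι} {x : ℕ} :
    x ∈ subsetSums a s ↔ ∃ F ⊆ s, ∑ i ∈ F, a i = x := by
  simp [subsetSums]

theorem subsetSums_insert {ι : Type*} [DecidableEq ι] (a : ι → ℕ) {s : Finset ι} {i : ι}
    (hi : i ∉ s) :
    subsetSums a (insert i s) = subsetSums a s ∪ (subsetSums a s).image (· + a i) := by
  rw [subsetSums, Finset.powerset_insert, Finset.image_union, Finset.image_image, subsetSums,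
    Finset.image_image]
  congr 1
  refine Finset.image_congr fun F hF => ?_
  have : i ∉ F := fun h => hi (Finset.mem_powerset.mp hF h)
  simp [Finset.sum_insert this, add_comm]

/-- Growth of Hilbert cubes contained in the squares. -/
theorem three_pow_le_two_pow_mul_card_subsetSums {ι : Type*} [DecidableEq ι] {a : ι → ℕ} {a₀ : ℕ}
    (ha : ∀ i, 0 < a i) (hsq : ∀ F : Finset ι, IsSquare (a₀ + ∑ i ∈ F, a i)) (s : Finset ι) :
    3 ^ s.card ≤ 2 ^ s.card * (subsetSums a s).card := by
  induction s using Finset.induction_on with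
  | empty => simp [subsetSums]
  | insert i s hi ih =>
    have hsq' : ∀ x ∈ subsetSums a (insert i s), ∃ m, a₀ + x = m ^ 2 := by
      intro x hx
      obtain ⟨F, -, rfl⟩ := mem_subsetSums.mp hx
      exact (isSquare_iff_exists_sq _).mp (hsq F)
    rw [subsetSums_insert a hi] at hsq' ⊢
    have := three_mul_card_le_two_mul_card_union_image_add (X := subsetSums a s) (e := a i) (by
      intro x h0 h1 h2
      obtain ⟨k, hk⟩ := hsq' x (Finset.mem_union_left _ h0)
      obtain ⟨l, hl⟩ := hsq' _ (Finset.mem_union_left _ h1)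
      obtain ⟨m, hm⟩ := hsq' _ (Finset.mem_union_left _ h2)
      obtain ⟨n, hn⟩ := hsq' _ (Finset.mem_union_right _ (Finset.mem_image_of_mem _ h2))
      exact not_four_sq_arithmetic_progression (ha i) hk (by rw [← hl]; ring)
        (by rw [← hm]; ring) (by rw [← hn]; ring))
    rw [Finset.card_insert_of_notMem hi, pow_succ, pow_succ]
    nlinarith [pow_pos (two_pos (α := ℕ)) s.card]

/-- Correlations of the quadratic character at distinct shifts have nonpositive sum. -/
theorem sum_quadraticChar_mul_quadraticChar_nonpos {K : Type*} [Field K] [Fintype K]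
    [DecidableEq K] (hK : ringChar K ≠ 2) {b c : K} (hbc : b ≠ c) :
    ∑ x, quadraticChar K (x + b) * quadraticChar K (x + c) ≤ 0 := by
  have hbij : Function.Bijective fun x : K => 1 + (c - b) * (x + b)⁻¹ := by
    rw [← Finite.injective_iff_bijective]
    intro x y hxy
    have h := mul_left_cancel₀ (sub_ne_zero.mpr hbc.symm) (add_left_cancel hxy)
    exact add_right_cancel (inv_injective h)
  have hzero : ∑ x, quadraticChar K (1 + (c - b) * (x + b)⁻¹) = 0 :=
    (hbij.sum_comp (quadraticChar K)).trans (quadraticChar_sum_zero hK)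
  refine (Finset.sum_le_sum fun x _ => ?_).trans_eq hzero
  by_cases hx : x + b = 0
  · rw [hx, MulChar.map_zero, zero_mul, inv_zero, mul_zero, add_zero, map_one]
    exact zero_le_one
  · have : x + c = (x + b) * (1 + (c - b) * (x + b)⁻¹) := by field_simp; ring
    rw [this, map_mul, ← mul_assoc, ← pow_two, quadraticChar_sq_one hx, one_mul]

/-- If `A + B` consists of squares in a finite field of odd characteristic, then `A` and `B`
cannot both be large. -/
theorem card_mul_sq_le_of_isSquare_add {K : Type*} [Field K] [Fintype K]
    [DecidableEq K] (hK : ringChar K ≠ 2) {A B : Finset K}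
    (h : ∀ x ∈ A, ∀ y ∈ B, IsSquare (x + y)) :
    A.card * (B.card - 1) ^ 2 ≤ Fintype.card K * B.card := by
  have lower : ∀ x ∈ A, ((B.card - 1 : ℕ) : ℤ) ^ 2 ≤ (∑ y ∈ B, quadraticChar K (x + y)) ^ 2 := by
    intro x hx
    refine pow_le_pow_left₀ (by positivity) ?_ 2
    have h1 : ((B.card - 1 : ℕ) : ℤ) ≤ (B.erase (-x)).card := by
      exact_mod_cast Finset.pred_card_le_card_erase
    refine h1.trans ?_
    have h2 : ∑ y ∈ B.erase (-x), quadraticChar K (x + y) = (B.erase (-x)).card := by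
      rw [Finset.card_eq_sum_ones, Nat.cast_sum]
      refine Finset.sum_congr rfl fun y hy => ?_
      obtain ⟨hne, hy⟩ := Finset.mem_erase.mp hy
      have : x + y ≠ 0 := fun h0 => hne (eq_neg_of_add_eq_zero_right h0)
      rw [(quadraticChar_one_iff_isSquare this).mpr (h x hx y hy), Nat.cast_one]
    rw [← h2]
    refine Finset.sum_le_sum_of_subset_of_nonneg (Finset.erase_subset _ _) fun y hy hy' => ?_
    have : y = -x := by
      by_contra hne
      exact hy' (Finset.mem_erase.mpr ⟨hne, hy⟩)
    simp [this]
  have upper : ∑ x : K, (∑ y ∈ B, quadraticChar K (x + y)) ^ 2 ≤ Fintype.card K * B.card := by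
    calc ∑ x : K, (∑ y ∈ B, quadraticChar K (x + y)) ^ 2
        = ∑ b ∈ B, ∑ c ∈ B, ∑ x : K, quadraticChar K (x + b) * quadraticChar K (x + c) := by
          simp_rw [pow_two, Finset.sum_mul_sum]
          rw [Finset.sum_comm]
          exact Finset.sum_congr rfl fun b _ => Finset.sum_comm
      _ ≤ ∑ b ∈ B, ∑ c ∈ B, if b = c then (Fintype.card K : ℤ) else 0 := by
          refine Finset.sum_le_sum fun b _ => Finset.sum_le_sum fun c _ => ?_
          split_ifs with hbc
          · subst hbc
            rw [← Finset.card_univ, Finset.card_eq_sum_ones, Nat.cast_sum]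
            refine Finset.sum_le_sum fun x _ => ?_
            by_cases hx : x + b = 0
            · simp [hx]
            · rw [← pow_two, quadraticChar_sq_one hx, Nat.cast_one]
          · exact sum_quadraticChar_mul_quadraticChar_nonpos hK hbc
      _ = Fintype.card K * B.card := by
          simp [Finset.sum_ite_eq, mul_comm]
  have : (A.card * (B.card - 1 : ℕ) ^ 2 : ℤ) ≤ Fintype.card K * B.card := by
    calc (A.card * (B.card - 1 : ℕ) ^ 2 : ℤ) = ∑ x ∈ A, ((B.card - 1 : ℕ) : ℤ) ^ 2 := by simp
      _ ≤ ∑ x ∈ A, (∑ y ∈ B, quadraticChar K (x + y)) ^ 2 := Finset.sum_le_sum lower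
      _ ≤ ∑ x : K, (∑ y ∈ B, quadraticChar K (x + y)) ^ 2 :=
          Finset.sum_le_univ_sum_of_nonneg fun _ => sq_nonneg _
      _ ≤ _ := upper
  exact_mod_cast this

theorem card_sq_le_or_card_sq_le_of_isSquare_add {p : ℕ} [Fact p.Prime] {A B : Finset (ZMod p)}
    (h : ∀ x ∈ A, ∀ y ∈ B, IsSquare (x + y)) :
    A.card ^ 2 ≤ 4 * p ∨ B.card ^ 2 ≤ 4 * p := by
  have hp : 2 ≤ p := (Fact.out : p.Prime).two_le
  rcases hp.eq_or_lt with rfl | hp2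
  · left
    have : A.card ≤ 2 := by simpa using Finset.card_le_univ A
    nlinarith
  rcases le_or_gt B.card 1 with hB | hB
  · right
    nlinarith
  have := card_mul_sq_le_of_isSquare_add (by rw [ZMod.ringChar_zmod_n]; omega) h
  rw [ZMod.card] at this
  obtain ⟨k, hk⟩ : ∃ k, B.card = k + 2 := ⟨B.card - 2, by omega⟩
  by_contra! hcon
  rw [hk, show k + 2 - 1 = k + 1 by omega] at this
  rw [hk] at hcon
  have h1 : A.card * (k + 2) ≤ 4 * p := by
    refine Nat.le_of_mul_le_mul_right (c := k + 2) ?_ (by omega)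
    calc A.card * (k + 2) * (k + 2) ≤ 4 * (A.card * (k + 1) ^ 2) := by
          nlinarith [Nat.zero_le (A.card * k), Nat.zero_le (A.card * k ^ 2)]
      _ ≤ 4 * p * (k + 2) := by linarith
  have h2 : (4 * p) * (4 * p) < A.card ^ 2 * (k + 2) ^ 2 :=
    Nat.mul_lt_mul'' hcon.1 hcon.2
  nlinarith

/-- Cauchy–Schwarz lower bound for the number of collisions of a map on a finite set. -/
theorem card_sq_le_card_image_mul_card_collisions {α β : Type*} [DecidableEq β]
    (X : Finset α) (f : α → β) :
    X.card ^ 2 ≤ (X.image f).card * ((X ×ˢ X).filter fun q => f q.1 = f q.2).card := by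
  have hcoll : ((X ×ˢ X).filter fun q => f q.1 = f q.2).card =
      ∑ c ∈ X.image f, (X.filter fun x => f x = c).card ^ 2 := by
    rw [Finset.card_eq_sum_card_fiberwise (f := fun q => f q.1) (t := X.image f)]
    · refine Finset.sum_congr rfl fun c _ => ?_
      rw [pow_two, ← Finset.card_product]
      congr 1
      ext q
      simp only [Finset.mem_filter, Finset.mem_product]
      constructor
      · rintro ⟨⟨⟨h1, h2⟩, h3⟩, h4⟩
        exact ⟨⟨h1, h4⟩, h2, h3 ▸ h4⟩
      · rintro ⟨⟨h1, h4⟩, h2, h3⟩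
        exact ⟨⟨⟨h1, h2⟩, h4.trans h3.symm⟩, h4⟩
    · intro q hq
      simp only [Finset.coe_filter, Finset.mem_product, Set.mem_ofPred_eq] at hq
      exact Finset.mem_coe.mpr (Finset.mem_image_of_mem _ hq.1.1)
  rw [hcoll, Finset.card_eq_sum_card_image f X]
  exact sq_sum_le_card_mul_sum_sq

/-- The primes dividing a positive integer contribute at most its logarithm. -/
theorem sum_log_filter_dvd_le_log {P : Finset ℕ} (hP : ∀ p ∈ P, p.Prime) {n : ℕ} (hn : 0 < n) :
    ∑ p ∈ P.filter (· ∣ n), Real.log p ≤ Real.log n := by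
  have hprime : ∀ p ∈ P.filter (· ∣ n), p.Prime := fun p hp => hP p (Finset.mem_filter.mp hp).1
  rw [← Real.log_prod fun p hp => by exact_mod_cast (hprime p hp).ne_zero]
  have hdvd : ∏ p ∈ P.filter (· ∣ n), p ∣ n :=
    Finset.prod_primes_dvd n (fun p hp => (hprime p hp).prime)
      fun p hp => (Finset.mem_filter.mp hp).2
  refine Real.log_le_log ?_ ?_
  · exact Finset.prod_pos fun p hp => by exact_mod_cast (hprime p hp).pos
  · rw [← Nat.cast_prod]
    exact Nat.cast_le.mpr (Nat.le_of_dvd hn hdvd)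

/-- Gallagher's larger sieve. -/
theorem sum_log_div_card_image_le {P : Finset ℕ} (hP : ∀ p ∈ P, p.Prime) {X : Finset ℕ} {N : ℕ}
    (hX : X.Nonempty) (hN : ∀ x ∈ X, x ≤ N) :
    ∑ p ∈ P, Real.log p / (X.image fun x : ℕ => (x : ZMod p)).card ≤
      (∑ p ∈ P, Real.log p) / X.card + Real.log N := by
  have hcard : (0 : ℝ) < X.card := by exact_mod_cast hX.card_pos
  have hlog : ∀ p ∈ P, 0 ≤ Real.log (p : ℝ) := fun p _ => Real.log_natCast_nonneg p
  have hθ : 0 ≤ ∑ p ∈ P, Real.log (p : ℝ) := Finset.sum_nonneg hlog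
  have hpair : ∀ q ∈ X ×ˢ X,
      ∑ p ∈ P.filter (fun p : ℕ => (q.1 : ZMod p) = q.2), Real.log p ≤
        (if q.1 = q.2 then ∑ p ∈ P, Real.log (p : ℝ) else 0) + Real.log N := by
    rintro ⟨x, y⟩ hq
    obtain ⟨hx, hy⟩ := Finset.mem_product.mp hq
    have hx := hN x hx
    have hy := hN y hy
    simp only at hx hy ⊢
    split_ifs with hxy
    · subst hxy
      simpa using Real.log_natCast_nonneg N
    · rw [zero_add]
      obtain ⟨n, hn0, hnN, hn⟩ : ∃ n : ℕ, 0 < n ∧ n ≤ N ∧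
          ∀ p : ℕ, (x : ZMod p) = y → p ∣ n := by
        rcases lt_or_gt_of_ne hxy with hlt | hlt
        · exact ⟨y - x, by omega, by omega, fun p hp =>
            (Nat.modEq_iff_dvd' hlt.le).mp ((ZMod.natCast_eq_natCast_iff _ _ _).mp hp)⟩
        · exact ⟨x - y, by omega, by omega, fun p hp =>
            (Nat.modEq_iff_dvd' hlt.le).mp ((ZMod.natCast_eq_natCast_iff _ _ _).mp hp.symm)⟩
      calc ∑ p ∈ P.filter (fun p : ℕ => (x : ZMod p) = y), Real.log p
          ≤ ∑ p ∈ P.filter (· ∣ n), Real.log p :=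
            Finset.sum_le_sum_of_subset_of_nonneg
              (Finset.monotone_filter_right _ fun p _ hp => hn p hp)
              fun p _ _ => Real.log_natCast_nonneg p
        _ ≤ Real.log n := sum_log_filter_dvd_le_log hP hn0
        _ ≤ Real.log N := Real.log_le_log (by exact_mod_cast hn0) (by exact_mod_cast hnN)
  have hterm : ∀ p ∈ P, Real.log p / (X.image fun x : ℕ => (x : ZMod p)).card ≤
      Real.log p * ((X ×ˢ X).filter fun q => (q.1 : ZMod p) = q.2).card / X.card ^ 2 := by
    intro p hp
    have hν : (0 : ℝ) < (X.image fun x : ℕ => (x : ZMod p)).card := by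
      exact_mod_cast (hX.image _).card_pos
    rw [div_le_div_iff₀ hν (by positivity), mul_assoc]
    refine mul_le_mul_of_nonneg_left ?_ (hlog p hp)
    rw [mul_comm]
    exact_mod_cast card_sq_le_card_image_mul_card_collisions X fun x : ℕ => (x : ZMod p)
  have hswap : ∑ p ∈ P, Real.log p * ((X ×ˢ X).filter fun q => (q.1 : ZMod p) = q.2).card =
      ∑ q ∈ X ×ˢ X, ∑ p ∈ P.filter (fun p : ℕ => (q.1 : ZMod p) = q.2), Real.log p := by
    simp_rw [Finset.sum_filter]
    rw [Finset.sum_comm]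
    refine Finset.sum_congr rfl fun p _ => ?_
    rw [← Finset.sum_filter, Finset.sum_const, nsmul_eq_mul, mul_comm]
  have hdiag : ∑ q ∈ X ×ˢ X, ((if q.1 = q.2 then ∑ p ∈ P, Real.log (p : ℝ) else 0) + Real.log N) =
      X.card * (∑ p ∈ P, Real.log (p : ℝ)) + X.card ^ 2 * Real.log N := by
    rw [Finset.sum_add_distrib, Finset.sum_product]
    congr 1
    · simp
    · simp [pow_two]
  calc ∑ p ∈ P, Real.log p / (X.image fun x : ℕ => (x : ZMod p)).card
      ≤ ∑ p ∈ P, Real.log p * ((X ×ˢ X).filter fun q => (q.1 : ZMod p) = q.2).card / X.card ^ 2 :=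
        Finset.sum_le_sum hterm
    _ = (∑ q ∈ X ×ˢ X, ∑ p ∈ P.filter (fun p : ℕ => (q.1 : ZMod p) = q.2), Real.log p) /
          X.card ^ 2 := by rw [← Finset.sum_div, hswap]
    _ ≤ (X.card * (∑ p ∈ P, Real.log (p : ℝ)) + X.card ^ 2 * Real.log N) / X.card ^ 2 := by
        rw [← hdiag]
        gcongr with q hq
        exact hpair q hq
    _ = _ := by field_simp

open Filter in
theorem eventually_sq_div_two_le_theta :
    ∀ᶠ k : ℕ in atTop, (k : ℝ) ^ 2 / 2 ≤ Chebyshev.theta ((k ^ 2 : ℕ) : ℝ) := by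
  have h : ∀ᶠ k : ℕ in atTop, ‖Real.log (k : ℝ)‖ ≤ 0.01 * ‖(k : ℝ)‖ :=
    tendsto_natCast_atTop_atTop.eventually (Real.isLittleO_log_id_atTop.def (by norm_num))
  filter_upwards [h, eventually_ge_atTop 20] with k hk hk20
  have hk20' : (20 : ℝ) ≤ k := by exact_mod_cast hk20
  rw [Real.norm_natCast] at hk
  have hk := (le_abs_self _).trans hk
  have hθ := Chebyshev.theta_ge (k ^ 2)
  have h1 : Real.log (((k ^ 2 : ℕ) : ℝ) + 1) ≤ 2 * k := by
    calc Real.log (((k ^ 2 : ℕ) : ℝ) + 1) ≤ Real.log (((k : ℝ) + 1) ^ 2) := by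
          refine Real.log_le_log (by positivity) ?_
          push_cast
          nlinarith
      _ = 2 * Real.log (k + 1) := by rw [Real.log_pow]; norm_num
      _ ≤ 2 * k := by
          have := Real.log_le_sub_one_of_pos (show (0 : ℝ) < k + 1 by positivity)
          linarith
  have h2 : √((k ^ 2 : ℕ) : ℝ) = k := by
    rw [Nat.cast_pow, Real.sqrt_sq (by positivity)]
  have h3 : Real.log ((k ^ 2 : ℕ) : ℝ) = 2 * Real.log k := by
    rw [Nat.cast_pow, Real.log_pow]; norm_num
  rw [h2, h3] at hθ
  refine le_trans ?_ hθ
  have h4 := Real.log_two_gt_d9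
  push_cast at h1 ⊢
  nlinarith

/-- If `A + B`, shifted by `a₀`, consists of squares and `A`, `B` both lie in `[0, N]`, then `A`
and `B` cannot both have many more than `log N` elements. -/
theorem le_mul_of_isSquare_add {A B : Finset ℕ} {a₀ N k : ℕ} {n : ℝ} (hn : 0 < n)
    (hnA : n ≤ A.card) (hnB : n ≤ B.card) (hA : ∀ x ∈ A, x ≤ N) (hB : ∀ x ∈ B, x ≤ N)
    (hsq : ∀ x ∈ A, ∀ y ∈ B, IsSquare (a₀ + (x + y))) (hk : 0 < k)
    (hkN : 16 * Real.log N ≤ k)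
    (hθ : (k : ℝ) ^ 2 / 2 ≤ Chebyshev.theta ((k ^ 2 : ℕ) : ℝ)) :
    n ≤ 8 * k := by
  set P := Nat.primesLE (k ^ 2)
  have hP : ∀ p ∈ P, p.Prime := fun p hp => (Nat.mem_primesLE.mp hp).2
  rw [Chebyshev.theta_eq_sum_primesLE_log] at hθ
  set θ := ∑ p ∈ P, Real.log (p : ℝ)
  have hk' : (0 : ℝ) < k := by exact_mod_cast hk
  have hθ0 : 0 < θ := lt_of_lt_of_le (by positivity) hθ
  have hAne : A.Nonempty := Finset.card_pos.mp (by exact_mod_cast hn.trans_le hnA)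
  have hBne : B.Nonempty := Finset.card_pos.mp (by exact_mod_cast hn.trans_le hnB)
  have hSA := sum_log_div_card_image_le hP hAne hA
  have hSB := sum_log_div_card_image_le hP hBne hB
  have hlow : θ / (2 * k) ≤ ∑ p ∈ P, Real.log p / (A.image fun x : ℕ => (x : ZMod p)).card +
      ∑ p ∈ P, Real.log p / (B.image fun x : ℕ => (x : ZMod p)).card := by
    rw [← Finset.sum_add_distrib, Finset.sum_div]
    refine Finset.sum_le_sum fun p hp => ?_
    have : Fact p.Prime := ⟨hP p hp⟩
    have hlog := Real.log_natCast_nonneg p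
    have hple : p ≤ k ^ 2 := (Nat.mem_primesLE.mp hp).1
    have hbound : ∀ C : Finset (ZMod p), C.card ^ 2 ≤ 4 * p → (C.card : ℝ) ≤ 2 * k := by
      intro C hC
      have : C.card ≤ 2 * k := by
        refine (Nat.pow_le_pow_iff_left two_ne_zero).mp ?_
        nlinarith
      exact_mod_cast this
    have hfield : ∀ x ∈ (A.image fun x : ℕ => (a₀ + x : ZMod p)),
        ∀ y ∈ (B.image fun x : ℕ => (x : ZMod p)), IsSquare (x + y) := by
      intro _ hx' _ hy'
      obtain ⟨x, hx, rfl⟩ := Finset.mem_image.mp hx'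
      obtain ⟨y, hy, rfl⟩ := Finset.mem_image.mp hy'
      have := (hsq x hx y hy).map (Nat.castRingHom (ZMod p))
      simpa [add_assoc] using this
    have hshift : (A.image fun x : ℕ => (a₀ + x : ZMod p)).card =
        (A.image fun x : ℕ => (x : ZMod p)).card := by
      rw [← Finset.card_image_of_injective (A.image fun x : ℕ => (x : ZMod p))
        (add_right_injective (a₀ : ZMod p)),
        Finset.image_image]
      rfl
    have hApos : (0 : ℝ) < (A.image fun x : ℕ => (x : ZMod p)).card := by
      exact_mod_cast (hAne.image _).card_pos
    have hBpos : (0 : ℝ) < (B.image fun x : ℕ => (x : ZMod p)).card := by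
      exact_mod_cast (hBne.image _).card_pos
    rcases card_sq_le_or_card_sq_le_of_isSquare_add hfield with h | h
    · rw [hshift] at h
      have := div_le_div_of_nonneg_left hlog hApos (hbound _ h)
      have := div_nonneg hlog hBpos.le
      linarith
    · have := div_le_div_of_nonneg_left hlog hBpos (hbound _ h)
      have := div_nonneg hlog hApos.le
      linarith
  have hA' : θ / A.card ≤ θ / n := div_le_div_of_nonneg_left hθ0.le hn hnA
  have hB' : θ / B.card ≤ θ / n := div_le_div_of_nonneg_left hθ0.le hn hnB
  have hlogN : 2 * Real.log N ≤ θ / (4 * k) := by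
    rw [le_div_iff₀ (by positivity)]
    nlinarith
  have hfin : θ / (4 * k) ≤ 2 * (θ / n) := by
    have : θ / (2 * k) = 2 * (θ / (4 * k)) := by field_simp; norm_num
    linarith
  rw [mul_div_assoc', div_le_div_iff₀ (by positivity) hn] at hfin
  refine le_of_mul_le_mul_left ?_ hθ0
  linarith

/-- Hilbert cubes in the squares: there is `N₀` such that for all `N ≥ N₀`,
if every element of the Hilbert cube `H(a₀; a₁, …, a_d)` (with `a₀ ≥ 0`,
`d ≥ 1` and all `aᵢ > 0`) is a positive perfect square at most `N`,
then `d ≤ 7 log log N`. -/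
theorem stmt_0 :
    ∃ N₀ : ℕ, ∀ N : ℕ, N₀ ≤ N →
      ∀ (d : ℕ) (a₀ : ℕ) (a : Fin d → ℕ),
        1 ≤ d →
        (∀ i, 0 < a i) →
        (∀ F : Finset (Fin d), (a₀ = 0 → F.Nonempty) →
          (∃ m : ℕ, 0 < m ∧ a₀ + ∑ i ∈ F, a i = m ^ 2) ∧ a₀ + ∑ i ∈ F, a i ≤ N) →
        (d : ℝ) ≤ 7 * Real.log (Real.log N) := by
  obtain ⟨K, hK⟩ := Filter.eventually_atTop.mp eventually_sq_div_two_le_theta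
  have hL : Filter.Tendsto (fun N : ℕ => Real.log (N : ℝ)) Filter.atTop Filter.atTop :=
    Real.tendsto_log_atTop.comp tendsto_natCast_atTop_atTop
  obtain ⟨N₀, hN₀⟩ := Filter.eventually_atTop.mp
    ((hL.eventually_ge_atTop (K + 1 : ℝ)).and
      ((Real.tendsto_log_atTop.comp hL).eventually_ge_atTop (1 + 6 * Real.log 136)))
  refine ⟨N₀, fun N hN d a₀ a _ ha h => ?_⟩
  obtain ⟨hLK, hLL⟩ := hN₀ N hN
  simp only [Function.comp_apply] at hLL
  set L := Real.log (N : ℝ)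
  have hL1 : 1 ≤ L := by linarith [Nat.cast_nonneg (α := ℝ) K]
  have hsq : ∀ F : Finset (Fin d), IsSquare (a₀ + ∑ i ∈ F, a i) := by
    intro F
    by_cases hF : a₀ = 0 → F.Nonempty
    · obtain ⟨⟨m, -, hm⟩, -⟩ := h F hF
      exact ⟨m, by rw [hm, pow_two]⟩
    · push Not at hF
      obtain ⟨rfl, rfl⟩ := hF
      simp
  have hle : ∀ F : Finset (Fin d), ∑ i ∈ F, a i ≤ N := by
    intro F
    rcases F.eq_empty_or_nonempty with rfl | hF
    · simp
    · exact (Nat.le_add_left _ _).trans (h F fun _ => hF).2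
  obtain ⟨s, -, hs⟩ := Finset.exists_subset_card_eq (s := (Finset.univ : Finset (Fin d)))
    (n := d / 2) (by rw [Finset.card_univ, Fintype.card_fin]; omega)
  obtain ⟨t, hts, ht⟩ := Finset.exists_subset_card_eq (s := sᶜ) (n := d / 2)
    (by rw [Finset.card_compl, Fintype.card_fin, hs]; omega)
  have hst : Disjoint s t := Finset.disjoint_of_subset_right hts disjoint_compl_right
  have hgrowth : ∀ u : Finset (Fin d), u.card = d / 2 →
      (3 / 2 : ℝ) ^ (d / 2) ≤ (subsetSums a u).card := by
    intro u hu
    have := three_pow_le_two_pow_mul_card_subsetSums ha hsq u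
    rw [hu] at this
    rw [div_pow, div_le_iff₀ (by positivity), mul_comm]
    exact_mod_cast this
  have hbound : ∀ u : Finset (Fin d), ∀ x ∈ subsetSums a u, x ≤ N := by
    intro u x hx
    obtain ⟨F, -, rfl⟩ := mem_subsetSums.mp hx
    exact hle F
  set k := ⌈16 * L⌉₊
  have hkL : 16 * L ≤ k := Nat.le_ceil _
  have hkL' : (k : ℝ) < 16 * L + 1 := Nat.ceil_lt_add_one (by linarith)
  have hkK : K ≤ k := by
    have : (K : ℝ) ≤ k := by linarith
    exact_mod_cast this
  have hk0 : 0 < k := Nat.ceil_pos.mpr (by linarith)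
  have hmain := le_mul_of_isSquare_add (a₀ := a₀) (by positivity) (hgrowth s hs) (hgrowth t ht)
    (hbound s) (hbound t) (fun x hx y hy => by
      obtain ⟨F, hF, rfl⟩ := mem_subsetSums.mp hx
      obtain ⟨G, hG, rfl⟩ := mem_subsetSums.mp hy
      rw [← Finset.sum_union (Finset.disjoint_of_subset_left hF
        (Finset.disjoint_of_subset_right hG hst))]
      exact hsq _) hk0 hkL (hK k hkK)
  have hlog := Real.log_le_log (by positivity) (hmain.trans (by linarith : 8 * (k : ℝ) ≤ 136 * L))
  rw [Real.log_pow, Real.log_mul (by norm_num) (by positivity)] at hlog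
  have h32 : (1 / 3 : ℝ) ≤ Real.log (3 / 2) := by
    have := Real.one_sub_inv_le_log_of_pos (show (0 : ℝ) < 3 / 2 by norm_num)
    norm_num at this ⊢
    exact this
  have hd : (d : ℝ) ≤ 2 * (d / 2 : ℕ) + 1 := by
    have : d ≤ 2 * (d / 2) + 1 := by omega
    exact_mod_cast this
  have hmul := mul_le_mul_of_nonneg_left h32 (Nat.cast_nonneg (α := ℝ) (d / 2))
  linarith
end

section
/- There exists N₀ such that for every integer N ≥ N₀ the following holds: if a₀ is a non-negative integer and a₁, …, a_d are positive integers (not necessarily distinct) such that every element of the Hilbert cube H(a₀; a₁, …, a_d) is a pure power at most N, then d ≤ 5 (log N)². -/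
/-- A pure power is a positive integer of the form `a ^ n` with `a ≥ 1`, `n ≥ 2`. -/
def IsPurePower (m : ℕ) : Prop := ∃ a n : ℕ, 1 ≤ a ∧ 2 ≤ n ∧ m = a ^ n

open Finset in
/-- A nonempty subset of `ZMod n` closed under adding a unit is everything. -/
lemma ZMod.eq_univ_of_add_unit_mem {n : ℕ} [NeZero n] {A : Finset (ZMod n)} (hA : A.Nonempty)
    {u : ZMod n} (hu : IsUnit u) (h : ∀ x ∈ A, x + u ∈ A) : A = univ := by
  obtain ⟨x, hx⟩ := hA
  have key : ∀ k : ℕ, x + k * u ∈ A := by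
    intro k
    induction k with
    | zero => simpa using hx
    | succ k ih =>
      have := h _ ih
      rwa [add_assoc, show (k : ZMod n) * u + u = ((k + 1 : ℕ) : ZMod n) * u by push_cast; ring]
        at this
  obtain ⟨v, hv⟩ := hu.exists_left_inv
  refine eq_univ_of_forall fun z ↦ ?_
  have := key ((z - x) * v).val
  rwa [ZMod.natCast_zmod_val, mul_assoc, hv, mul_one, add_sub_cancel] at this

open Finset in
/-- The subset sums of `k` units of `ZMod n` take at least `min n (k + 1)` values. -/
lemma ZMod.min_le_card_subset_sums {n : ℕ} [NeZero n] {ι : Type*} [DecidableEq ι]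
    (f : ι → ZMod n) (S : Finset ι) (hS : ∀ i ∈ S, IsUnit (f i)) :
    min n (#S + 1) ≤ #(S.powerset.image fun F ↦ ∑ i ∈ F, f i) := by
  induction S using Finset.induction_on with
  | empty => simp
  | insert i S hi ih =>
    have ih := ih fun j hj ↦ hS j (mem_insert_of_mem hj)
    set A := S.powerset.image fun F ↦ ∑ i ∈ F, f i
    set B := (insert i S).powerset.image fun F ↦ ∑ i ∈ F, f i
    have hAB : A ⊆ B := image_subset_image (powerset_mono.2 (subset_insert i S))
    have hadd : ∀ x ∈ A, x + f i ∈ B := by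
      intro x hx
      obtain ⟨F, hF, rfl⟩ := mem_image.1 hx
      rw [mem_powerset] at hF
      refine mem_image.2 ⟨insert i F, mem_powerset.2 (insert_subset_insert i hF), ?_⟩
      rw [sum_insert fun h ↦ hi (hF h), add_comm]
    rw [card_insert_of_notMem hi]
    rcases hAB.eq_or_ssubset with h | h
    · have hne : A.Nonempty := ⟨0, mem_image.2 ⟨∅, by simp, by simp⟩⟩
      have hA : A = univ := ZMod.eq_univ_of_add_unit_mem hne (hS i (mem_insert_self i S))
        fun x hx ↦ h ▸ hadd x hx
      rw [← h, hA, card_univ, ZMod.card]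
      exact min_le_left _ _
    · have := card_lt_card h
      omega

/-- A pure power divisible by a prime `p` is divisible by `p ^ 2`. -/
lemma IsPurePower.sq_dvd {m p : ℕ} (hm : IsPurePower m) (hp : p.Prime) (h : p ∣ m) :
    p ^ 2 ∣ m := by
  obtain ⟨a, n, -, hn, rfl⟩ := hm
  exact (pow_dvd_pow_of_dvd (hp.dvd_of_dvd_pow h) 2).trans (pow_dvd_pow a hn)

open Finset in
/-- In a Hilbert cube of pure powers, at most `p ^ 2` generators are coprime to `p`. -/
lemma card_not_dvd_le_sq {d a₀ : ℕ} {a : Fin d → ℕ}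
    (h : ∀ F : Finset (Fin d), (a₀ = 0 → F.Nonempty) → IsPurePower (a₀ + ∑ i ∈ F, a i))
    {p : ℕ} (hp : p.Prime) : #{i | ¬ p ∣ a i} ≤ p ^ 2 := by
  by_contra! hlt
  have : NeZero (p ^ 2) := ⟨pow_ne_zero 2 hp.ne_zero⟩
  set S : Finset (Fin d) := {i | ¬ p ∣ a i} with hSdef
  have hcard := ZMod.min_le_card_subset_sums (n := p ^ 2) (fun i ↦ (a i : ZMod (p ^ 2))) S (by
    intro i hi
    rw [ZMod.isUnit_iff_coprime]
    exact (((Nat.Prime.coprime_iff_not_dvd hp).2 (by simpa [hSdef] using hi)).symm).pow_right 2)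
  rw [min_eq_left (by omega)] at hcard
  have huniv := eq_univ_of_card (S.powerset.image fun F ↦ ∑ i ∈ F, (a i : ZMod (p ^ 2)))
    (le_antisymm (card_le_univ _) (by rwa [ZMod.card]))
  have hmem := mem_univ ((p : ZMod (p ^ 2)) - a₀)
  rw [← huniv, mem_image] at hmem
  obtain ⟨F, -, hF⟩ := hmem
  have hcongr : a₀ + ∑ i ∈ F, a i ≡ p [MOD p ^ 2] := by
    rw [← ZMod.natCast_eq_natCast_iff]
    push_cast
    rw [hF]
    ring
  have hnd : ¬ p ^ 2 ∣ p := fun hd ↦ by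
    have := Nat.le_of_dvd hp.pos hd
    nlinarith [hp.two_le]
  have hnd' : ¬ p ^ 2 ∣ a₀ + ∑ i ∈ F, a i := fun hd ↦ hnd ((hcongr.dvd_iff dvd_rfl).1 hd)
  refine hnd' ((h F fun h0 ↦ ?_).sq_dvd hp
    ((hcongr.dvd_iff (dvd_pow_self p two_ne_zero)).2 dvd_rfl))
  rw [nonempty_iff_ne_empty]
  rintro rfl
  simp [h0] at hnd'

open Finset in
/-- The logarithms of distinct primes dividing `m` add up to at most `log m`. -/
lemma sum_log_primes_dvd_le_log {m : ℕ} (hm : 0 < m) (P : Finset ℕ) (hP : ∀ p ∈ P, p.Prime) :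
    ∑ p ∈ P with p ∣ m, Real.log p ≤ Real.log m := by
  have hpos : ∀ p ∈ P.filter (· ∣ m), (p : ℝ) ≠ 0 := fun p hp ↦
    Nat.cast_ne_zero.2 (hP p (mem_filter.1 hp).1).ne_zero
  rw [← Real.log_prod hpos]
  have hdvd : ∏ p ∈ P with p ∣ m, p ∣ m := prod_primes_dvd m
    (fun p hp ↦ (hP p (mem_filter.1 hp).1).prime) fun p hp ↦ (mem_filter.1 hp).2
  refine Real.log_le_log (prod_pos fun p hp ↦ ?_) ?_
  · exact lt_of_le_of_ne (Nat.cast_nonneg p) (hpos p hp).symm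
  · rw [← Nat.cast_prod]
    exact Nat.cast_le.2 (Nat.le_of_dvd hm hdvd)

open Finset in
/-- Double counting of the pairs `(i, p)` with `p ∣ a i`. -/
lemma sum_sub_sq_mul_log_le {N d a₀ : ℕ} {a : Fin d → ℕ} (ha : ∀ i, 0 < a i)
    (h : ∀ F : Finset (Fin d), (a₀ = 0 → F.Nonempty) →
      IsPurePower (a₀ + ∑ i ∈ F, a i) ∧ a₀ + ∑ i ∈ F, a i ≤ N)
    (P : Finset ℕ) (hP : ∀ p ∈ P, p.Prime) :
    ∑ p ∈ P, ((d : ℝ) - p ^ 2) * Real.log p ≤ d * Real.log N := by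
  calc ∑ p ∈ P, ((d : ℝ) - p ^ 2) * Real.log p
      ≤ ∑ p ∈ P, ∑ i : Fin d, if p ∣ a i then Real.log p else 0 := by
        refine sum_le_sum fun p hp ↦ ?_
        rw [← sum_filter, sum_const, nsmul_eq_mul]
        refine mul_le_mul_of_nonneg_right ?_ (Real.log_natCast_nonneg p)
        have h1 := card_not_dvd_le_sq (fun F hF ↦ (h F hF).1) (hP p hp)
        have h2 := card_filter_add_card_filter_not (s := (univ : Finset (Fin d))) (fun i ↦ p ∣ a i)
        rw [card_univ, Fintype.card_fin] at h2
        have h3 : d ≤ #{i | p ∣ a i} + p ^ 2 := by omega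
        have h4 : (d : ℝ) ≤ #{i | p ∣ a i} + (p : ℝ) ^ 2 := by exact_mod_cast h3
        linarith
    _ = ∑ i : Fin d, ∑ p ∈ P with p ∣ a i, Real.log p := by
        rw [sum_comm]
        exact sum_congr rfl fun i _ ↦ (sum_filter _ _).symm
    _ ≤ ∑ _i : Fin d, Real.log N := by
        refine sum_le_sum fun i _ ↦ (sum_log_primes_dvd_le_log (ha i) P hP).trans ?_
        have := (h {i} fun _ ↦ singleton_nonempty i).2
        rw [sum_singleton] at this
        exact Real.log_le_log (Nat.cast_pos.2 (ha i)) (Nat.cast_le.2 (by omega))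
    _ = d * Real.log N := by simp

open Filter Asymptotics in
/-- A linear lower bound for the Chebyshev function. -/
lemma exists_theta_natCast_ge :
    ∃ K : ℝ, 0 ≤ K ∧ ∀ n : ℕ, 0.68 * (n : ℝ) - K ≤ Chebyshev.theta n := by
  have h1 : (fun x : ℝ ↦ Real.log (x + 1) + 2 * √x * Real.log x) =o[atTop] fun x ↦ x := by
    refine IsLittleO.add ?_ ?_
    · refine ((Real.isLittleO_log_id_atTop.comp_tendsto
        (tendsto_atTop_add_const_right atTop (1 : ℝ) tendsto_id)).trans_isBigO ?_)
      refine IsBigO.of_bound 2 ?_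
      filter_upwards [eventually_ge_atTop 1] with x hx
      simp only [Function.comp_apply, id, Real.norm_eq_abs]
      rw [abs_of_nonneg (by linarith), abs_of_nonneg (by linarith)]
      linarith
    · have h2 := (isBigO_refl (fun x : ℝ ↦ 2 * √x) atTop).mul_isLittleO
        (isLittleO_log_rpow_atTop (r := 1 / 2) (by norm_num))
      refine h2.trans_isBigO (IsBigO.of_bound 2 ?_)
      filter_upwards [eventually_ge_atTop 0] with x hx
      rw [← Real.sqrt_eq_rpow, mul_assoc, Real.mul_self_sqrt hx, norm_mul]
      norm_num
  have h2 := h1.bound (show (0 : ℝ) < 0.01 by norm_num)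
  obtain ⟨M, hM⟩ := eventually_atTop.1 h2
  refine ⟨|M|, abs_nonneg M, fun n ↦ ?_⟩
  rcases le_total M n with hn | hn
  · have h3 := hM n hn
    rw [Real.norm_eq_abs, Real.norm_of_nonneg (Nat.cast_nonneg n)] at h3
    have h4 := Chebyshev.theta_ge n
    have h5 := (abs_le.1 h3).2
    nlinarith [Real.log_two_gt_d9, abs_nonneg M, (Nat.cast_nonneg n : (0 : ℝ) ≤ n)]
  · have := Chebyshev.theta_nonneg (n : ℝ)
    have h6 := le_abs_self M
    have h7 : (0 : ℝ) ≤ n := Nat.cast_nonneg n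
    linarith

open Finset in
/-- Summation by parts: a linear lower bound for `θ` gives a cubic lower bound for
`∑ p ≤ y, (y ^ 2 - p ^ 2) * log p`. -/
lemma sum_sq_sub_sq_mul_log_ge {c K : ℝ} (hc : 0 ≤ c)
    (hθ : ∀ n : ℕ, c * (n : ℝ) - K ≤ Chebyshev.theta n) (y : ℕ) :
    2 / 3 * c * (y : ℝ) ^ 3 - (K + c) * (y : ℝ) ^ 2 ≤
      ∑ p ∈ Nat.primesLE y, ((y : ℝ) ^ 2 - (p : ℝ) ^ 2) * Real.log p := by
  induction y with
  | zero => simp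
  | succ y ih =>
    have hstep : ∑ p ∈ Nat.primesLE (y + 1),
          (((y + 1 : ℕ) : ℝ) ^ 2 - (p : ℝ) ^ 2) * Real.log p =
        ∑ p ∈ Nat.primesLE y, ((y : ℝ) ^ 2 - (p : ℝ) ^ 2) * Real.log p +
          (2 * y + 1) * Chebyshev.theta y := by
      rw [Chebyshev.theta_eq_sum_primesLE_log, mul_sum, ← sum_add_distrib]
      have hsub : Nat.primesLE y ⊆ Nat.primesLE (y + 1) := fun p hp ↦ by
        rw [Nat.mem_primesLE] at hp ⊢
        exact ⟨by omega, hp.2⟩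
      rw [← sum_subset hsub]
      · refine sum_congr rfl fun p _ ↦ ?_
        push_cast
        ring
      · intro p hp hp'
        rw [Nat.mem_primesLE] at hp hp'
        have : p = y + 1 := by
          by_contra hne
          exact hp' ⟨by omega, hp.2⟩
        simp [this]
    rw [hstep]
    have hy : (0 : ℝ) ≤ y := Nat.cast_nonneg y
    have := mul_le_mul_of_nonneg_left (hθ y) (show (0 : ℝ) ≤ 2 * y + 1 by linarith)
    push_cast
    nlinarith

/-- Hilbert cubes in pure powers: `d ≤ 5 (log N)²`. -/
theorem stmt_7 :
    ∃ N₀ : ℕ, ∀ N : ℕ, N₀ ≤ N →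
      ∀ (d : ℕ) (a₀ : ℕ) (a : Fin d → ℕ),
        (∀ i, 0 < a i) →
        (∀ F : Finset (Fin d), (a₀ = 0 → F.Nonempty) →
          IsPurePower (a₀ + ∑ i ∈ F, a i) ∧ a₀ + ∑ i ∈ F, a i ≤ N) →
        (d : ℝ) ≤ 5 * (Real.log N) ^ 2 := by
  obtain ⟨K, hK, hθ⟩ := exists_theta_natCast_ge
  obtain ⟨N₀, hN₀⟩ := Filter.eventually_atTop.1
    ((Real.tendsto_log_atTop.comp tendsto_natCast_atTop_atTop).eventually_ge_atTop
      (1000 * (K + 4)))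
  refine ⟨N₀, fun N hN d a₀ a ha h ↦ ?_⟩
  have hL : 1000 * (K + 4) ≤ Real.log N := hN₀ N hN
  set L := Real.log N
  by_contra! hlt
  set y := Nat.sqrt d
  have hy1 : (y : ℝ) ^ 2 ≤ d := by exact_mod_cast Nat.sqrt_le' d
  have hy2 : (d : ℝ) ≤ (y : ℝ) ^ 2 + 2 * y := by
    have : d ≤ y * y + y + y := Nat.sqrt_le_add d
    have : (d : ℝ) ≤ (y : ℝ) * y + y + y := by exact_mod_cast this
    linarith
  have hy0 : (0 : ℝ) ≤ y := Nat.cast_nonneg y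
  have hLy : L ≤ 0.448 * (y + 1) := by
    refine le_of_sq_le_sq ?_ (by positivity)
    nlinarith
  have hS := sum_sq_sub_sq_mul_log_ge (by norm_num) hθ y
  have hS' := sum_sub_sq_mul_log_le ha h (Nat.primesLE y) fun p hp ↦ Nat.prime_of_mem_primesLE hp
  have hmono : ∑ p ∈ Nat.primesLE y, ((y : ℝ) ^ 2 - (p : ℝ) ^ 2) * Real.log p ≤
      ∑ p ∈ Nat.primesLE y, ((d : ℝ) - p ^ 2) * Real.log p :=
    Finset.sum_le_sum fun p _ ↦
      mul_le_mul_of_nonneg_right (by linarith) (Real.log_natCast_nonneg p)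
  have hmain : 2 / 3 * 0.68 * (y : ℝ) ^ 3 - (K + 0.68) * (y : ℝ) ^ 2 ≤
      ((y : ℝ) ^ 2 + 2 * y) * (0.448 * (y + 1)) := by
    have h1 : (d : ℝ) * L ≤ ((y : ℝ) ^ 2 + 2 * y) * (0.448 * (y + 1)) :=
      mul_le_mul hy2 hLy (by linarith) (by positivity)
    linarith
  have hylarge : 1000 * (K + 4) ≤ (y : ℝ) := by linarith
  have hypos : (0 : ℝ) < y := by linarith
  have hquad : 2 / 3 * 0.68 * (y : ℝ) ^ 2 - (K + 0.68) * y ≤ (y + 2) * (0.448 * (y + 1)) := by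
    refine le_of_mul_le_mul_left ?_ hypos
    nlinarith
  nlinarith
end
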